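/- Under the G₁-Assumption, and assuming min_{i≤k} ‖q_iᵀX‖₂ > 0 and min_{i≤k} ‖e_iᵀV‖₂ > 0, one has δ_k(Y) ≤ Γ_{k,m}(QᵀX) · Γ_{k,m}(V) · ‖G₁† E_k‖₂, where ‖·‖₂ on a matrix denotes the spectral (operator 2-) norm. -/

import Mathlib

open Matrix

namespace ARR

/-- Euclidean norm of the `i`-th row of a matrix. -/
noncomputable def rowNorm {R C : Type*} [Fintype C] (M : Matrix R C ℝ) (i : R) : ℝ :=
  Real.sqrt (∑ j, M i j ^ 2)

/-- Supremum of `f` over indices satisfying `P`. -/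
noncomputable def supOver {n : ℕ} (P : Fin n → Prop) (f : Fin n → ℝ) : ℝ :=
  sSup (f '' {i | P i})

/-- Infimum of `f` over indices satisfying `P`. -/
noncomputable def infOver {n : ℕ} (P : Fin n → Prop) (f : Fin n → ℝ) : ℝ :=
  sInf (f '' {i | P i})

/-- The accuracy measure `δₖ(Z) = max_{i>k} ‖qᵢᵀZ‖ / min_{i≤k} ‖qᵢᵀZ‖`
(indices are 1-based in the paper; here `i > k` means `k ≤ i` for 0-based `i`). -/
noncomputable def deltaK {n k : ℕ} (Q : Matrix (Fin n) (Fin n) ℝ)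
    (Z : Matrix (Fin n) (Fin k) ℝ) : ℝ :=
  supOver (fun i => k ≤ (i : ℕ)) (rowNorm (Qᵀ * Z)) /
    infOver (fun i => (i : ℕ) < k) (rowNorm (Qᵀ * Z))

/-- `Γ_{k,m}(M) = max_{i>m} ‖eᵢᵀM‖ / min_{i≤k} ‖eᵢᵀM‖`. -/
noncomputable def gammaKM {n : ℕ} {C : Type*} [Fintype C] (k m : ℕ)
    (M : Matrix (Fin n) C ℝ) : ℝ :=
  supOver (fun i => m ≤ (i : ℕ)) (rowNorm M) / infOver (fun i => (i : ℕ) < k) (rowNorm M)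

/-- Spectral (operator 2-) norm of a matrix. -/
noncomputable def specNorm {a b : Type*} [Fintype a] [Fintype b] [DecidableEq b]
    (M : Matrix a b ℝ) : ℝ :=
  ‖LinearMap.toContinuousLinearMap (Matrix.toEuclideanLin M)‖

/-- The Vandermonde matrix `V` with `V i j = λᵢ^j`, `0 ≤ j ≤ p`. -/
def vand {n : ℕ} (lam : Fin n → ℝ) (p : ℕ) : Matrix (Fin n) (Fin (p + 1)) ℝ :=
  fun i j => lam i ^ (j : ℕ)

/-- The diagonal of `D`: `Dᵢᵢ = ‖qᵢᵀX‖₂ ⬝ ‖eᵢᵀV‖₂` (the norm of the `i`-th row of `Ĝ`). -/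
noncomputable def dvec {n k : ℕ} (lam : Fin n → ℝ) (p : ℕ) (Q : Matrix (Fin n) (Fin n) ℝ)
    (X : Matrix (Fin n) (Fin k) ℝ) : Fin n → ℝ :=
  fun i => rowNorm (Qᵀ * X) i * rowNorm (vand lam p) i

/-- `G = D† Ĝ`, where `Ĝ = [QᵀX, ΛQᵀX, …, ΛᵖQᵀX]`; the column block index is `j.1`. -/
noncomputable def gmat {n k : ℕ} (lam : Fin n → ℝ) (p : ℕ) (Q : Matrix (Fin n) (Fin n) ℝ)
    (X : Matrix (Fin n) (Fin k) ℝ) : Matrix (Fin n) (Fin (p + 1) × Fin k) ℝ :=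
  fun i j => (dvec lam p Q X i)⁻¹ * (lam i ^ (j.1 : ℕ) * (Qᵀ * X) i j.2)

/-- The augmented matrix `X_p = [X, AX, …, AᵖX]`; the column block index is `j.1`. -/
noncomputable def aug {n k : ℕ} (A : Matrix (Fin n) (Fin n) ℝ)
    (X : Matrix (Fin n) (Fin k) ℝ) (p : ℕ) : Matrix (Fin n) (Fin (p + 1) × Fin k) ℝ :=
  fun i j => (A ^ (j.1 : ℕ) * X) i j.2

/-- First `m` rows of a matrix. -/
def topRows {n : ℕ} {C : Type*} (m : ℕ) (hmn : m ≤ n) (M : Matrix (Fin n) C ℝ) :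
    Matrix (Fin m) C ℝ :=
  fun i j => M (Fin.castLE hmn i) j

/-- Last `n - m` rows of a matrix. -/
def lowRows {n : ℕ} {C : Type*} (m : ℕ) (hmn : m ≤ n) (M : Matrix (Fin n) C ℝ) :
    Matrix (Fin (n - m)) C ℝ :=
  fun i j => M ⟨m + (i : ℕ), by have := i.isLt; omega⟩ j

/-- First `m` columns of a square matrix (`Q_m`). -/
def colsTop {n : ℕ} (m : ℕ) (hmn : m ≤ n) (M : Matrix (Fin n) (Fin n) ℝ) :
    Matrix (Fin n) (Fin m) ℝ :=
  fun i j => M i (Fin.castLE hmn j)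

/-- Last `n - m` columns of a square matrix (`Q_{m+}`). -/
def colsLow {n : ℕ} (m : ℕ) (hmn : m ≤ n) (M : Matrix (Fin n) (Fin n) ℝ) :
    Matrix (Fin n) (Fin (n - m)) ℝ :=
  fun i j => M i ⟨m + (j : ℕ), by have := j.isLt; omega⟩

/-- `E_k`: the first `k` columns of the `m × m` identity matrix. -/
def ekMat (m k : ℕ) : Matrix (Fin m) (Fin k) ℝ :=
  fun i j => if (i : ℕ) = (j : ℕ) then 1 else 0

/-- `D₁⁻¹`: the inverse of the leading `m × m` block of `D`. -/
noncomputable def d1inv {n : ℕ} (m : ℕ) (hmn : m ≤ n) (d : Fin n → ℝ) :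
    Matrix (Fin m) (Fin m) ℝ :=
  Matrix.diagonal fun i => (d (Fin.castLE hmn i))⁻¹

/-- `D₂`: the trailing `(n-m) × (n-m)` block of `D`. -/
noncomputable def d2mat {n : ℕ} (m : ℕ) (hmn : m ≤ n) (d : Fin n → ℝ) :
    Matrix (Fin (n - m)) (Fin (n - m)) ℝ :=
  Matrix.diagonal fun i => d ⟨m + (i : ℕ), by have := i.isLt; omega⟩

/-- `Y = X_p G₁† D₁⁻¹ E_k`, where `A = Q Λ Qᵀ` and `X_p = [X, AX, …, AᵖX]`. -/
noncomputable def ymat {n k : ℕ} (m : ℕ) (hmn : m ≤ n) (lam : Fin n → ℝ) (p : ℕ)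
    (Q : Matrix (Fin n) (Fin n) ℝ) (X : Matrix (Fin n) (Fin k) ℝ)
    (Gpinv : Matrix (Fin (p + 1) × Fin k) (Fin m) ℝ) : Matrix (Fin n) (Fin k) ℝ :=
  aug (Q * Matrix.diagonal lam * Qᵀ) X p * Gpinv * d1inv m hmn (dvec lam p Q X) * ekMat m k

end ARR

namespace ARR

theorem rowNorm_nonneg {R C : Type*} [Fintype C] (M : Matrix R C ℝ) (i : R) :
    0 ≤ rowNorm M i :=
  Real.sqrt_nonneg _

theorem rowNorm_eq_norm {R C : Type*} [Fintype C] (M : Matrix R C ℝ) (i : R) :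
    rowNorm M i = ‖(WithLp.toLp 2 (M i) : EuclideanSpace ℝ C)‖ := by
  simp [rowNorm, EuclideanSpace.norm_eq]

theorem specNorm_nonneg {a b : Type*} [Fintype a] [Fintype b] [DecidableEq b]
    (M : Matrix a b ℝ) : 0 ≤ specNorm M :=
  norm_nonneg _

theorem rowNorm_mul_le {R a b : Type*} [Fintype a] [Fintype b] [DecidableEq b]
    (A : Matrix R a ℝ) (B : Matrix a b ℝ) (i : R) :
    rowNorm (A * B) i ≤ rowNorm A i * specNorm B := by
  rw [rowNorm_eq_norm, rowNorm_eq_norm]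
  set w : EuclideanSpace ℝ b := WithLp.toLp 2 ((A * B) i) with hw
  set v : EuclideanSpace ℝ a := WithLp.toLp 2 (A i) with hv
  have hop : ‖Matrix.toEuclideanLin B w‖ ≤ specNorm B * ‖w‖ :=
    (LinearMap.toContinuousLinearMap (Matrix.toEuclideanLin B)).le_opNorm w
  have hinner : inner ℝ v (Matrix.toEuclideanLin B w) = ‖w‖ ^ 2 := by
    have h : A i ⬝ᵥ (B *ᵥ (A * B) i) = (A * B) i ⬝ᵥ (A * B) i := by
      rw [Matrix.dotProduct_mulVec, Matrix.mul_apply_eq_vecMul]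
    rw [← real_inner_self_eq_norm_sq]
    simp only [hv, hw, EuclideanSpace.inner_eq_star_dotProduct, Matrix.toLpLin_apply,
      star_trivial]
    rw [dotProduct_comm, h]
  have hcs := real_inner_le_norm v (Matrix.toEuclideanLin B w)
  rcases (norm_nonneg w).eq_or_lt with h0 | h0
  · rw [← h0]
    exact mul_nonneg (norm_nonneg _) (specNorm_nonneg B)
  · refine le_of_mul_le_mul_right ?_ h0
    calc ‖w‖ * ‖w‖ = inner ℝ v (Matrix.toEuclideanLin B w) := by rw [hinner, sq]
      _ ≤ ‖v‖ * ‖Matrix.toEuclideanLin B w‖ := hcs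
      _ ≤ ‖v‖ * (specNorm B * ‖w‖) := by gcongr
      _ = ‖v‖ * specNorm B * ‖w‖ := by ring

theorem rowNorm_mul_diagonal_le {R C : Type*} [Fintype C] [DecidableEq C]
    (M : Matrix R C ℝ) (c : C → ℝ) {b : ℝ} (hc : ∀ j, 0 ≤ c j) (hcb : ∀ j, c j ≤ b)
    (hb : 0 ≤ b) (i : R) :
    rowNorm (M * Matrix.diagonal c) i ≤ rowNorm M i * b := by
  unfold rowNorm
  rw [← Real.sqrt_sq hb, ← Real.sqrt_mul (by positivity), Finset.sum_mul]
  refine Real.sqrt_le_sqrt (Finset.sum_le_sum fun j _ => ?_)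
  rw [Matrix.mul_diagonal, mul_pow]
  have := hc j
  have := hcb j
  gcongr

theorem le_supOver {n : ℕ} {P : Fin n → Prop} (f : Fin n → ℝ) {i : Fin n} (hi : P i) :
    f i ≤ supOver P f :=
  le_csSup ((Set.toFinite _).image f).bddAbove ⟨i, hi, rfl⟩

theorem infOver_le {n : ℕ} {P : Fin n → Prop} (f : Fin n → ℝ) {i : Fin n} (hi : P i) :
    infOver P f ≤ f i :=
  csInf_le ((Set.toFinite _).image f).bddBelow ⟨i, hi, rfl⟩

theorem supOver_nonneg {n : ℕ} {P : Fin n → Prop} {f : Fin n → ℝ} (hf : ∀ i, 0 ≤ f i) :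
    0 ≤ supOver P f := by
  refine Real.sSup_nonneg ?_
  rintro _ ⟨i, -, rfl⟩
  exact hf i

theorem supOver_le {n : ℕ} {P : Fin n → Prop} {f : Fin n → ℝ} {c : ℝ} (hc : 0 ≤ c)
    (hf : ∀ i, P i → f i ≤ c) : supOver P f ≤ c := by
  refine Real.sSup_le ?_ hc
  rintro _ ⟨i, hi, rfl⟩
  exact hf i hi

theorem infOver_eq_of_const {n : ℕ} {P : Fin n → Prop} {f : Fin n → ℝ} {c : ℝ}
    (hP : ∃ i, P i) (hf : ∀ i, P i → f i = c) : infOver P f = c := by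
  have h : f '' {i | P i} = {c} := by
    obtain ⟨i₀, h₀⟩ := hP
    ext y
    constructor
    · rintro ⟨i, hi, rfl⟩
      exact hf i hi
    · rintro rfl
      exact ⟨i₀, h₀, hf i₀ h₀⟩
  rw [infOver, h, csInf_singleton]

/-- The matrix `Ĝ = [QᵀX, ΛQᵀX, …, ΛᵖQᵀX]`, with `W = QᵀX`. -/
def ghat {n k : ℕ} (lam : Fin n → ℝ) (p : ℕ) (W : Matrix (Fin n) (Fin k) ℝ) :
    Matrix (Fin n) (Fin (p + 1) × Fin k) ℝ :=
  fun i j => lam i ^ (j.1 : ℕ) * W i j.2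

theorem rowNorm_ghat {n k : ℕ} (lam : Fin n → ℝ) (p : ℕ) (W : Matrix (Fin n) (Fin k) ℝ)
    (i : Fin n) : rowNorm (ghat lam p W) i = rowNorm W i * rowNorm (vand lam p) i := by
  unfold rowNorm ghat vand
  rw [← Real.sqrt_mul (by positivity), mul_comm, Finset.sum_mul_sum, Fintype.sum_prod_type]
  simp only [mul_pow]

theorem transpose_mul_pow {n : ℕ} (lam : Fin n → ℝ) (Q : Matrix (Fin n) (Fin n) ℝ)
    (hQ : Qᵀ * Q = 1) (j : ℕ) :
    Qᵀ * (Q * Matrix.diagonal lam * Qᵀ) ^ j = Matrix.diagonal lam ^ j * Qᵀ := by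
  have h : SemiconjBy Qᵀ (Q * Matrix.diagonal lam * Qᵀ) (Matrix.diagonal lam) := by
    rw [SemiconjBy, ← mul_assoc, ← mul_assoc, hQ, one_mul]
  exact h.pow_right j

theorem transpose_mul_aug {n k : ℕ} (lam : Fin n → ℝ) (p : ℕ) (Q : Matrix (Fin n) (Fin n) ℝ)
    (hQ : Qᵀ * Q = 1) (X : Matrix (Fin n) (Fin k) ℝ) :
    Qᵀ * aug (Q * Matrix.diagonal lam * Qᵀ) X p = ghat lam p (Qᵀ * X) := by
  ext i j
  have h : (Qᵀ * aug (Q * Matrix.diagonal lam * Qᵀ) X p) i j =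
      (Qᵀ * ((Q * Matrix.diagonal lam * Qᵀ) ^ (j.1 : ℕ) * X)) i j.2 := rfl
  rw [h, ← Matrix.mul_assoc, transpose_mul_pow lam Q hQ, Matrix.mul_assoc,
    Matrix.diagonal_pow, Matrix.diagonal_mul]
  rfl

theorem d1inv_mul_ekMat {n m k : ℕ} (hkm : k ≤ m) (hmn : m ≤ n) (d : Fin n → ℝ) :
    d1inv m hmn d * ekMat m k =
      ekMat m k * Matrix.diagonal fun j => (d (Fin.castLE (hkm.trans hmn) j))⁻¹ := by
  ext i j
  rw [d1inv, Matrix.diagonal_mul, Matrix.mul_diagonal]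
  by_cases h : (i : ℕ) = j
  · have : Fin.castLE hmn i = Fin.castLE (hkm.trans hmn) j := Fin.ext h
    rw [this, mul_comm]
  · simp [ekMat, h]

theorem ghat_mul_apply {n k p m : ℕ} (hmn : m ≤ n) (lam : Fin n → ℝ)
    (Q : Matrix (Fin n) (Fin n) ℝ) (X : Matrix (Fin n) (Fin k) ℝ)
    (Gpinv : Matrix (Fin (p + 1) × Fin k) (Fin m) ℝ)
    (hG1 : topRows m hmn (gmat lam p Q X) * Gpinv = 1) (i j : Fin m)
    (hd : dvec lam p Q X (Fin.castLE hmn i) ≠ 0) :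
    (ghat lam p (Qᵀ * X) * Gpinv) (Fin.castLE hmn i) j =
      dvec lam p Q X (Fin.castLE hmn i) * (1 : Matrix (Fin m) (Fin m) ℝ) i j := by
  rw [← hG1, Matrix.mul_apply, Matrix.mul_apply, Finset.mul_sum]
  refine Finset.sum_congr rfl fun c _ => ?_
  simp only [ghat, topRows, gmat]
  field_simp

theorem dvec_ne_zero {n k p m : ℕ} (hmn : m ≤ n) (lam : Fin n → ℝ)
    (Q : Matrix (Fin n) (Fin n) ℝ) (X : Matrix (Fin n) (Fin k) ℝ)
    (Gpinv : Matrix (Fin (p + 1) × Fin k) (Fin m) ℝ)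
    (hG1 : topRows m hmn (gmat lam p Q X) * Gpinv = 1) (i : Fin m) :
    dvec lam p Q X (Fin.castLE hmn i) ≠ 0 := by
  intro h
  have h1 := congrFun (congrFun hG1 i) i
  rw [Matrix.mul_apply, Matrix.one_apply_eq] at h1
  simp [topRows, gmat, h] at h1

theorem transpose_mul_ymat_apply {n k p m : ℕ} (hmn : m ≤ n) (lam : Fin n → ℝ)
    (Q : Matrix (Fin n) (Fin n) ℝ) (hQ : Qᵀ * Q = 1) (X : Matrix (Fin n) (Fin k) ℝ)
    (Gpinv : Matrix (Fin (p + 1) × Fin k) (Fin m) ℝ)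
    (hG1 : topRows m hmn (gmat lam p Q X) * Gpinv = 1) (i : Fin m) (j : Fin k) :
    (Qᵀ * ymat m hmn lam p Q X Gpinv) (Fin.castLE hmn i) j = ekMat m k i j := by
  have hd := dvec_ne_zero hmn lam Q X Gpinv hG1 i
  have h : Qᵀ * ymat m hmn lam p Q X Gpinv =
      (ghat lam p (Qᵀ * X) * Gpinv) * (d1inv m hmn (dvec lam p Q X) * ekMat m k) := by
    simp only [ymat, ← Matrix.mul_assoc]
    rw [Matrix.mul_assoc, Matrix.mul_assoc, ← transpose_mul_aug lam p Q hQ X]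
    simp only [Matrix.mul_assoc]
  rw [h, Matrix.mul_apply]
  simp only [ghat_mul_apply hmn lam Q X Gpinv hG1 i _ hd, Matrix.one_apply, mul_ite, mul_one,
    mul_zero, ite_mul, zero_mul, Finset.sum_ite_eq, Finset.mem_univ, if_true]
  rw [d1inv, Matrix.diagonal_mul, mul_inv_cancel_left₀ hd]

theorem rowNorm_ekMat_of_lt {m k : ℕ} (i : Fin m) (hi : (i : ℕ) < k) :
    rowNorm (ekMat m k) i = 1 := by
  have h : ∀ j : Fin k, ekMat m k i j ^ 2 = if (⟨i, hi⟩ : Fin k) = j then 1 else 0 := by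
    intro j
    by_cases hij : (i : ℕ) = j <;> simp [ekMat, Fin.ext_iff, hij]
  simp [rowNorm, h]

theorem rowNorm_ekMat_of_le {m k : ℕ} (i : Fin m) (hi : k ≤ (i : ℕ)) :
    rowNorm (ekMat m k) i = 0 := by
  have h : ∀ j : Fin k, ekMat m k i j = 0 := by
    intro j
    have : (i : ℕ) ≠ j := by omega
    simp [ekMat, this]
  simp [rowNorm, h]

theorem rowNorm_transpose_mul_ymat_le {n k p m : ℕ} (hkm : k ≤ m) (hmn : m ≤ n)
    (lam : Fin n → ℝ) (Q : Matrix (Fin n) (Fin n) ℝ) (hQ : Qᵀ * Q = 1)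
    (X : Matrix (Fin n) (Fin k) ℝ) (Gpinv : Matrix (Fin (p + 1) × Fin k) (Fin m) ℝ)
    (hX : 0 < infOver (fun i => (i : ℕ) < k) (rowNorm (Qᵀ * X)))
    (hV : 0 < infOver (fun i => (i : ℕ) < k) (rowNorm (vand lam p))) (i : Fin n) :
    rowNorm (Qᵀ * ymat m hmn lam p Q X Gpinv) i ≤
      rowNorm (Qᵀ * X) i * rowNorm (vand lam p) i * specNorm (Gpinv * ekMat m k) *
        (infOver (fun i => (i : ℕ) < k) (rowNorm (Qᵀ * X)) *
          infOver (fun i => (i : ℕ) < k) (rowNorm (vand lam p)))⁻¹ := by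
  have h : Qᵀ * ymat m hmn lam p Q X Gpinv =
      ghat lam p (Qᵀ * X) * (Gpinv * ekMat m k) *
        Matrix.diagonal fun j => (dvec lam p Q X (Fin.castLE (hkm.trans hmn) j))⁻¹ := by
    rw [Matrix.mul_assoc _ (Gpinv * _), Matrix.mul_assoc Gpinv, ← d1inv_mul_ekMat hkm hmn,
      ← transpose_mul_aug lam p Q hQ X]
    simp only [ymat, Matrix.mul_assoc]
  have hpos := mul_pos hX hV
  rw [h, ← rowNorm_ghat]
  refine (rowNorm_mul_diagonal_le _ _ (fun j => ?_) (fun j => ?_)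
    (inv_nonneg.2 hpos.le) i).trans ?_
  · exact inv_nonneg.2 (mul_nonneg (rowNorm_nonneg _ _) (rowNorm_nonneg _ _))
  · have hj : ((Fin.castLE (hkm.trans hmn) j : Fin n) : ℕ) < k := j.isLt
    refine inv_anti₀ hpos (mul_le_mul ?_ ?_ hV.le (rowNorm_nonneg _ _))
    · exact infOver_le (P := fun i : Fin n => (i : ℕ) < k) _ hj
    · exact infOver_le (P := fun i : Fin n => (i : ℕ) < k) _ hj
  · exact mul_le_mul_of_nonneg_right (rowNorm_mul_le _ _ i) (inv_nonneg.2 hpos.le)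

end ARR

open ARR in
/-- first part of Theorem 3.1 of the paper. Under the `G₁`-Assumption,
`δₖ(Y) ≤ Γ_{k,m}(QᵀX) ⬝ Γ_{k,m}(V) ⬝ ‖G₁† E_k‖₂` (spectral norm). -/
theorem arr_thm1_part1 {n k p m : ℕ} (hk : 0 < k) (hn : (p + 1) * k < n)
    (hkm : k ≤ m) (hmk : m ≤ k + p * k) (hmn : m ≤ n)
    (lam : Fin n → ℝ) (hlam : Antitone lam)
    (Q : Matrix (Fin n) (Fin n) ℝ) (hQ : Q * Qᵀ = 1) (hQ' : Qᵀ * Q = 1)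
    (X : Matrix (Fin n) (Fin k) ℝ)
    (Gpinv : Matrix (Fin (p + 1) × Fin k) (Fin m) ℝ)
    (hG1 : topRows m hmn (gmat lam p Q X) * Gpinv = 1)
    (hX : 0 < infOver (fun i => (i : ℕ) < k) (rowNorm (Qᵀ * X)))
    (hV : 0 < infOver (fun i => (i : ℕ) < k) (rowNorm (vand lam p))) :
    deltaK Q (ymat m hmn lam p Q X Gpinv) ≤
      gammaKM k m (Qᵀ * X) * gammaKM k m (vand lam p) * specNorm (Gpinv * ekMat m k) := by
  have row (i : Fin n) (hi : (i : ℕ) < m) :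
      rowNorm (Qᵀ * ymat m hmn lam p Q X Gpinv) i = rowNorm (ekMat m k) ⟨i, hi⟩ := by
    unfold rowNorm
    congr 1
    refine Finset.sum_congr rfl fun j _ => ?_
    rw [← transpose_mul_ymat_apply hmn lam Q hQ' X Gpinv hG1 ⟨i, hi⟩ j]
    rfl
  have hinf : infOver (fun i => (i : ℕ) < k)
      (rowNorm (Qᵀ * ymat m hmn lam p Q X Gpinv)) = 1 := by
    refine infOver_eq_of_const ⟨⟨0, by omega⟩, hk⟩ fun i hi => ?_
    rw [row i (hi.trans_le hkm), rowNorm_ekMat_of_lt ⟨i, hi.trans_le hkm⟩ hi]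
  have hsX : 0 ≤ supOver (fun i => m ≤ (i : ℕ)) (rowNorm (Qᵀ * X)) :=
    supOver_nonneg (rowNorm_nonneg _)
  have hsV : 0 ≤ supOver (fun i => m ≤ (i : ℕ)) (rowNorm (vand lam p)) :=
    supOver_nonneg (rowNorm_nonneg _)
  have hS := specNorm_nonneg (Gpinv * ekMat m k)
  rw [deltaK, hinf, div_one]
  have hnonneg : 0 ≤ gammaKM k m (Qᵀ * X) * gammaKM k m (vand lam p) *
      specNorm (Gpinv * ekMat m k) :=
    mul_nonneg (mul_nonneg (div_nonneg hsX hX.le) (div_nonneg hsV hV.le)) hS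
  refine supOver_le hnonneg fun i hi => ?_
  rcases lt_or_ge (i : ℕ) m with him | him
  · rwa [row i him, rowNorm_ekMat_of_le ⟨i, him⟩ hi]
  · refine (rowNorm_transpose_mul_ymat_le hkm hmn lam Q hQ' X Gpinv hX hV i).trans ?_
    have h1 := le_supOver (P := fun i : Fin n => m ≤ (i : ℕ)) (rowNorm (Qᵀ * X)) him
    have h2 := le_supOver (P := fun i : Fin n => m ≤ (i : ℕ)) (rowNorm (vand lam p)) him
    calc _ ≤ supOver (fun i => m ≤ (i : ℕ)) (rowNorm (Qᵀ * X)) *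
          supOver (fun i => m ≤ (i : ℕ)) (rowNorm (vand lam p)) *
          specNorm (Gpinv * ekMat m k) *
          (infOver (fun i => (i : ℕ) < k) (rowNorm (Qᵀ * X)) *
            infOver (fun i => (i : ℕ) < k) (rowNorm (vand lam p)))⁻¹ := by
          have := rowNorm_nonneg (vand lam p) i
          gcongr
      _ = _ := by
          rw [gammaKM, gammaKM, mul_inv]
          ring
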